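/- arXiv:2202.07577 — 2 statements merged into one kernel-verified Lean document; each statement's English description precedes it below -/
import Mathlib

section
/- Let (M,·,1) be a monoid and let S be a naturally ordered ω-continuous M-module. Then for every M-wGCL program C, the weakest preweighting transformer wp[C] is a well-defined ω-continuous endofunction on the M-module 𝕎 of weightings over S; in particular, for a loop while(φ){C'} with wp-characteristic function Φ_f(X) = [¬φ]⋄f ⊕ [φ]⋄wp[C'](X), the least fixed point defining wp[while(φ){C'}](f) exists and equals the supremum ⨆_{i∈ℕ} Φ_f^i(𝟘) of the Kleene iterates from 𝟘. -/
/-! ## Monoid modules, natural order, ω-(co)continuity -/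

structure MonModule (M : Type) [Monoid M] (S : Type) where
  add : S → S → S
  zero : S
  smul : M → S → S
  add_assoc : ∀ a b c : S, add (add a b) c = add a (add b c)
  add_comm : ∀ a b : S, add a b = add b a
  add_zero : ∀ a : S, add a zero = a
  smul_assoc : ∀ (u v : M) (a : S), smul (u * v) a = smul u (smul v a)
  smul_add : ∀ (u : M) (a b : S), smul u (add a b) = add (smul u a) (smul u b)
  one_smul : ∀ a : S, smul 1 a = a
  smul_zero : ∀ u : M, smul u zero = zero

namespace MonModule

variable {M S : Type} [Monoid M]

/-- The natural (pre)order: `a ⪯ b` iff `∃ c, a ⊕ c = b`. -/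
def le (mm : MonModule M S) (a b : S) : Prop := ∃ c : S, mm.add a c = b

/-- `S` is naturally ordered if the natural order is antisymmetric (hence a partial order). -/
def NaturallyOrdered (mm : MonModule M S) : Prop :=
  ∀ a b : S, mm.le a b → mm.le b a → a = b

/-- ω-chain (ascending). -/
def Chain (mm : MonModule M S) (s : ℕ → S) : Prop := ∀ n : ℕ, mm.le (s n) (s (n + 1))

/-- ω-descending chain. -/
def DChain (mm : MonModule M S) (s : ℕ → S) : Prop := ∀ n : ℕ, mm.le (s (n + 1)) (s n)

/-- `x` is the supremum (least upper bound) of `s` w.r.t. the natural order. -/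
def IsSup (mm : MonModule M S) (s : ℕ → S) (x : S) : Prop :=
  (∀ n : ℕ, mm.le (s n) x) ∧ ∀ y : S, (∀ n : ℕ, mm.le (s n) y) → mm.le x y

/-- `x` is the infimum (greatest lower bound) of `s` w.r.t. the natural order. -/
def IsInf (mm : MonModule M S) (s : ℕ → S) (x : S) : Prop :=
  (∀ n : ℕ, mm.le x (s n)) ∧ ∀ y : S, (∀ n : ℕ, mm.le y (s n)) → mm.le y x

end MonModule

/-- `S` is ω-continuous: suprema of ω-chains exist (with least element `𝟘`, which is
automatically least for the natural order), and `⊕`, `⊗` are ω-continuous. -/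
structure OmegaContinuous {M S : Type} [Monoid M] (mm : MonModule M S) : Prop where
  sup_exists : ∀ s : ℕ → S, mm.Chain s → ∃ x : S, mm.IsSup s x
  add_cont : ∀ (a : S) (s : ℕ → S) (x : S), mm.Chain s → mm.IsSup s x →
    mm.IsSup (fun n => mm.add a (s n)) (mm.add a x)
  smul_cont : ∀ (u : M) (s : ℕ → S) (x : S), mm.Chain s → mm.IsSup s x →
    mm.IsSup (fun n => mm.smul u (s n)) (mm.smul u x)

/-- `S` is ω-cocontinuous: a greatest element exists, infima of ω-descending chains exist,
and `⊕`, `⊗` are ω-cocontinuous. -/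
structure OmegaCocontinuous {M S : Type} [Monoid M] (mm : MonModule M S) : Prop where
  top_exists : ∃ t : S, ∀ a : S, mm.le a t
  inf_exists : ∀ s : ℕ → S, mm.DChain s → ∃ x : S, mm.IsInf s x
  add_cocont : ∀ (a : S) (s : ℕ → S) (x : S), mm.DChain s → mm.IsInf s x →
    mm.IsInf (fun n => mm.add a (s n)) (mm.add a x)
  smul_cocont : ∀ (u : M) (s : ℕ → S) (x : S), mm.DChain s → mm.IsInf s x →
    mm.IsInf (fun n => mm.smul u (s n)) (mm.smul u x)

def OmegaBicontinuous {M S : Type} [Monoid M] (mm : MonModule M S) : Prop :=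
  OmegaContinuous mm ∧ OmegaCocontinuous mm

/-! ## Weightings (pointwise lifting to `St → S`) -/

section Weightings

variable {M S St : Type} [Monoid M]

/-- Pointwise natural order on weightings. -/
def wle (mm : MonModule M S) (f g : St → S) : Prop := ∀ σ : St, mm.le (f σ) (g σ)

def WChain (mm : MonModule M S) (s : ℕ → St → S) : Prop := ∀ n : ℕ, wle mm (s n) (s (n + 1))

def WDChain (mm : MonModule M S) (s : ℕ → St → S) : Prop := ∀ n : ℕ, wle mm (s (n + 1)) (s n)

def WIsSup (mm : MonModule M S) (s : ℕ → St → S) (x : St → S) : Prop :=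
  (∀ n : ℕ, wle mm (s n) x) ∧ ∀ y : St → S, (∀ n : ℕ, wle mm (s n) y) → wle mm x y

def WIsInf (mm : MonModule M S) (s : ℕ → St → S) (x : St → S) : Prop :=
  (∀ n : ℕ, wle mm x (s n)) ∧ ∀ y : St → S, (∀ n : ℕ, wle mm y (s n)) → wle mm y x

end Weightings

/-! ## wGCL syntax -/

/-- wGCL programs over weights from `M` and program states from `St`:
assignments (as state transformations), sequencing, conditionals, nondeterministic
branching, weighting `⊙ a`, and loops. -/
inductive WGCL (M : Type) (St : Type) : Type
  | assign : (St → St) → WGCL M St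
  | seq : WGCL M St → WGCL M St → WGCL M St
  | ite : Set St → WGCL M St → WGCL M St → WGCL M St
  | branch : WGCL M St → WGCL M St → WGCL M St
  | weight : M → WGCL M St
  | wloop : Set St → WGCL M St → WGCL M St

section Transformers

variable {M S St : Type} [Monoid M]

/-- Iverson-bracket guarding `[φ] ⋄ f`. -/
noncomputable def iv (mm : MonModule M S) (φ : Set St) (f : St → S) : St → S :=
  fun σ => @ite _ (σ ∈ φ) (Classical.propDecidable _) (f σ) mm.zero

/-- Least fixed point of `Φ` w.r.t. the pointwise natural order (chosen by classical choice
if it exists; arbitrary otherwise). -/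
noncomputable def wlfp (mm : MonModule M S) (Φ : (St → S) → St → S) : St → S :=
  @dite _ (∃ x : St → S, Φ x = x ∧ ∀ y : St → S, Φ y = y → wle mm x y)
    (Classical.propDecidable _) (fun h => h.choose) (fun _ => fun _ => mm.zero)

/-- Greatest fixed point of `Φ` w.r.t. the pointwise natural order. -/
noncomputable def wgfp (mm : MonModule M S) (Φ : (St → S) → St → S) : St → S :=
  @dite _ (∃ x : St → S, Φ x = x ∧ ∀ y : St → S, Φ y = y → wle mm y x)
    (Classical.propDecidable _) (fun h => h.choose) (fun _ => fun _ => mm.zero)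

/-- Weakest preweighting transformer `wp`. -/
noncomputable def wp (mm : MonModule M S) : WGCL M St → (St → S) → St → S
  | WGCL.assign g => fun f σ => f (g σ)
  | WGCL.seq C₁ C₂ => fun f => wp mm C₁ (wp mm C₂ f)
  | WGCL.ite φ C₁ C₂ => fun f σ => mm.add (iv mm φ (wp mm C₁ f) σ) (iv mm φᶜ (wp mm C₂ f) σ)
  | WGCL.branch C₁ C₂ => fun f σ => mm.add (wp mm C₁ f σ) (wp mm C₂ f σ)
  | WGCL.weight a => fun f σ => mm.smul a (f σ)
  | WGCL.wloop φ C' => fun f =>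
      wlfp mm (fun X σ => mm.add (iv mm φᶜ f σ) (iv mm φ (wp mm C' X) σ))

/-- The `wp`-characteristic function `Φ_f(X) = [¬φ]⋄f ⊕ [φ]⋄wp[C'](X)` of `while(φ){C'}`. -/
noncomputable def charW (mm : MonModule M S) (φ : Set St) (C' : WGCL M St) (f : St → S)
    (X : St → S) : St → S :=
  fun σ => mm.add (iv mm φᶜ f σ) (iv mm φ (wp mm C' X) σ)

/-- Weakest liberal preweighting transformer `wlp`. -/
noncomputable def wlp (mm : MonModule M S) : WGCL M St → (St → S) → St → S
  | WGCL.assign g => fun f σ => f (g σ)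
  | WGCL.seq C₁ C₂ => fun f => wlp mm C₁ (wlp mm C₂ f)
  | WGCL.ite φ C₁ C₂ => fun f σ => mm.add (iv mm φ (wlp mm C₁ f) σ) (iv mm φᶜ (wlp mm C₂ f) σ)
  | WGCL.branch C₁ C₂ => fun f σ => mm.add (wlp mm C₁ f σ) (wlp mm C₂ f σ)
  | WGCL.weight a => fun f σ => mm.smul a (f σ)
  | WGCL.wloop φ C' => fun f =>
      wgfp mm (fun X σ => mm.add (iv mm φᶜ f σ) (iv mm φ (wlp mm C' X) σ))

/-- The `wlp`-characteristic function `Ψ_f(X) = [¬φ]⋄f ⊕ [φ]⋄wlp[C'](X)` of `while(φ){C'}`. -/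
noncomputable def charWlp (mm : MonModule M S) (φ : Set St) (C' : WGCL M St) (f : St → S)
    (X : St → S) : St → S :=
  fun σ => mm.add (iv mm φᶜ f σ) (iv mm φ (wlp mm C' X) σ)

end Transformers

/-! ## Operational semantics -/

/-- Configurations: `none` is a terminal configuration. -/
abbrev Conf (M St : Type) := Option (WGCL M St) × St

section Operational

variable {M St : Type} [Monoid M]

/-- Weighted small-step operational semantics: each transition carries a weight in `M`
(the weight `a` for executing `⊙ a`, and `1` otherwise). -/
inductive Step : Conf M St → M → Conf M St → Prop
  | assign (g : St → St) (σ : St) : Step (some (WGCL.assign g), σ) 1 (none, g σ)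
  | weight (a : M) (σ : St) : Step (some (WGCL.weight a), σ) a (none, σ)
  | seq_fin {C₁ : WGCL M St} {σ : St} {w : M} {σ' : St} (C₂ : WGCL M St) :
      Step (some C₁, σ) w (none, σ') → Step (some (WGCL.seq C₁ C₂), σ) w (some C₂, σ')
  | seq_step {C₁ : WGCL M St} {σ : St} {w : M} {C₁' : WGCL M St} {σ' : St} (C₂ : WGCL M St) :
      Step (some C₁, σ) w (some C₁', σ') →
      Step (some (WGCL.seq C₁ C₂), σ) w (some (WGCL.seq C₁' C₂), σ')
  | ite_left {φ : Set St} {σ : St} (C₁ C₂ : WGCL M St) :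
      σ ∈ φ → Step (some (WGCL.ite φ C₁ C₂), σ) 1 (some C₁, σ)
  | ite_right {φ : Set St} {σ : St} (C₁ C₂ : WGCL M St) :
      σ ∉ φ → Step (some (WGCL.ite φ C₁ C₂), σ) 1 (some C₂, σ)
  | branch_left (C₁ C₂ : WGCL M St) (σ : St) :
      Step (some (WGCL.branch C₁ C₂), σ) 1 (some C₁, σ)
  | branch_right (C₁ C₂ : WGCL M St) (σ : St) :
      Step (some (WGCL.branch C₁ C₂), σ) 1 (some C₂, σ)
  | loop_enter {φ : Set St} {σ : St} (C : WGCL M St) :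
      σ ∈ φ → Step (some (WGCL.wloop φ C), σ) 1 (some (WGCL.seq C (WGCL.wloop φ C)), σ)
  | loop_exit {φ : Set St} {σ : St} (C : WGCL M St) :
      σ ∉ φ → Step (some (WGCL.wloop φ C), σ) 1 (none, σ)

/-- A finite computation path from configuration `c`, recorded as the list of
(transition weight, successor configuration) pairs. -/
inductive Steps : Conf M St → List (M × Conf M St) → Prop
  | nil (c : Conf M St) : Steps c []
  | cons {c : Conf M St} {w : M} {c' : Conf M St} {l : List (M × Conf M St)} :
      Step c w c' → Steps c' l → Steps c ((w, c') :: l)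

/-- Weight of a computation path: the ordered product of its transition weights. -/
def pathWeight (l : List (M × Conf M St)) : M := (l.map Prod.fst).prod

/-- Final state of a (nonempty) computation path; `σ` for the empty path. -/
def lastState (σ : St) (l : List (M × Conf M St)) : St :=
  (l.getLastD ((1 : M), ((none : Option (WGCL M St)), σ))).2.2

/-- A terminating computation path from `c`: a finite path ending in a terminal
configuration. -/
def TermPath (c : Conf M St) (l : List (M × Conf M St)) : Prop :=
  Steps c l ∧ ∃ p : M × Conf M St, l.getLast? = some p ∧ p.2.1 = (none : Option (WGCL M St))

/-- There is an infinite computation path starting in `c`. -/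
def InfinitePathFrom (c : Conf M St) : Prop :=
  ∃ π : ℕ → Conf M St, π 0 = c ∧ ∀ n : ℕ, ∃ w : M, Step (π n) w (π (n + 1))

end Operational

/-! ## Countable module sums as suprema of finite partial sums -/

section Sums

variable {M S : Type} [Monoid M]

/-- Finite sum of `g` over the elements of a list. -/
def finListSum (mm : MonModule M S) {ι : Type} (g : ι → S) : List ι → S
  | [] => mm.zero
  | i :: t => mm.add (g i) (finListSum mm g t)

/-- `x` is the (countable) module sum `⨁_{i ∈ T} g i`, i.e. the least upper bound
of all finite partial sums over duplicate-free lists of elements of `T`. -/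
def IsSumOver (mm : MonModule M S) {ι : Type} (T : Set ι) (g : ι → S) (x : S) : Prop :=
  (∀ l : List ι, l.Nodup → (∀ i ∈ l, i ∈ T) → mm.le (finListSum mm g l) x) ∧
  ∀ y : S, (∀ l : List ι, l.Nodup → (∀ i ∈ l, i ∈ T) → mm.le (finListSum mm g l) y) → mm.le x y

end Sums

namespace MonModule

variable {M S : Type} [Monoid M] {mm : MonModule M S}

theorem le_refl (mm : MonModule M S) (a : S) : mm.le a a := ⟨mm.zero, mm.add_zero a⟩

theorem le_trans {a b c : S} : mm.le a b → mm.le b c → mm.le a c := by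
  rintro ⟨d, rfl⟩ ⟨e, rfl⟩
  exact ⟨mm.add d e, (mm.add_assoc a d e).symm⟩

theorem zero_le (mm : MonModule M S) (a : S) : mm.le mm.zero a :=
  ⟨a, by rw [mm.add_comm, mm.add_zero]⟩

theorem add_le_add_left (a : S) {b c : S} : mm.le b c → mm.le (mm.add a b) (mm.add a c) := by
  rintro ⟨d, rfl⟩
  exact ⟨d, mm.add_assoc a b d⟩

theorem add_le_add {a b c d : S} (hab : mm.le a b) (hcd : mm.le c d) :
    mm.le (mm.add a c) (mm.add b d) := by
  refine le_trans (add_le_add_left a hcd) ?_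
  rw [mm.add_comm a, mm.add_comm b]
  exact add_le_add_left d hab

theorem smul_le_smul (u : M) {a b : S} : mm.le a b → mm.le (mm.smul u a) (mm.smul u b) := by
  rintro ⟨c, rfl⟩
  exact ⟨mm.smul u c, (mm.smul_add u a c).symm⟩

theorem Chain.le_of_le {s : ℕ → S} (hs : mm.Chain s) {m n : ℕ} (h : m ≤ n) :
    mm.le (s m) (s n) := by
  induction n, h using Nat.le_induction with
  | base => exact mm.le_refl _
  | succ n _ ih => exact le_trans ih (hs n)

theorem IsSup.unique (hord : mm.NaturallyOrdered) {s : ℕ → S} {x y : S}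
    (hx : mm.IsSup s x) (hy : mm.IsSup s y) : x = y :=
  hord x y (hx.2 y hy.1) (hy.2 x hx.1)

theorem isSup_const (mm : MonModule M S) (a : S) : mm.IsSup (fun _ => a) a :=
  ⟨fun _ => mm.le_refl a, fun _ h => h 0⟩

theorem IsSup.succ {s : ℕ → S} {x : S} (hs : mm.Chain s) (hx : mm.IsSup s x) :
    mm.IsSup (fun n => s (n + 1)) x :=
  ⟨fun n => hx.1 (n + 1), fun y hy => hx.2 y fun n => le_trans (hs n) (hy n)⟩

/-- Addition, being ω-continuous in each argument, is jointly ω-continuous. -/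
theorem IsSup.add (hcont : OmegaContinuous mm) {s t : ℕ → S} {x y : S}
    (hs : mm.Chain s) (ht : mm.Chain t) (hx : mm.IsSup s x) (hy : mm.IsSup t y) :
    mm.IsSup (fun n => mm.add (s n) (t n)) (mm.add x y) := by
  refine ⟨fun n => add_le_add (hx.1 n) (hy.1 n), fun z hz => ?_⟩
  have hrow (n : ℕ) : mm.le (mm.add (s n) y) z :=
    (hcont.add_cont (s n) t y ht hy).2 z fun m =>
      le_trans (add_le_add (hs.le_of_le (le_max_left n m)) (ht.le_of_le (le_max_right n m)))
        (hz (max n m))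
  rw [mm.add_comm]
  refine (hcont.add_cont y s x hs hx).2 z fun n => ?_
  simpa only [mm.add_comm] using hrow n

end MonModule

section Weightings

variable {M S St : Type} [Monoid M] {mm : MonModule M S}

theorem wle_trans {f g h : St → S} (hfg : wle mm f g) (hgh : wle mm g h) : wle mm f h :=
  fun σ => MonModule.le_trans (hfg σ) (hgh σ)

/-- Suprema of weightings are computed pointwise. -/
theorem wIsSup_iff {s : ℕ → St → S} {x : St → S} :
    WIsSup mm s x ↔ ∀ σ, mm.IsSup (fun n => s n σ) (x σ) := by
  classical
  refine ⟨fun h σ => ⟨fun n => h.1 n σ, fun y hy => ?_⟩,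
    fun h => ⟨fun n σ => (h σ).1 n, fun y hy σ => (h σ).2 (y σ) fun n => hy n σ⟩⟩
  have hle : wle mm x (Function.update x σ y) := h.2 _ fun n τ => by
    rcases eq_or_ne τ σ with rfl | hτ
    · simpa using hy n
    · simpa [hτ] using h.1 n τ
  simpa using hle σ

theorem exists_wIsSup (hcont : OmegaContinuous mm) {s : ℕ → St → S} (hs : WChain mm s) :
    ∃ x, WIsSup mm s x := by
  choose x hx using fun σ => hcont.sup_exists (fun n => s n σ) fun n => hs n σ
  exact ⟨x, wIsSup_iff.2 hx⟩

/-- ω-continuous endofunctions on weightings: monotone and preserving suprema of ω-chains. -/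
def WContinuous (mm : MonModule M S) (F : (St → S) → St → S) : Prop :=
  (∀ f g : St → S, wle mm f g → wle mm (F f) (F g)) ∧
  ∀ (s : ℕ → St → S) (x : St → S), WChain mm s → WIsSup mm s x →
    WIsSup mm (fun n => F (s n)) (F x)

namespace WContinuous

theorem chain {F : (St → S) → St → S} (hF : WContinuous mm F) {s : ℕ → St → S}
    (hs : WChain mm s) : WChain mm fun n => F (s n) :=
  fun n => hF.1 _ _ (hs n)

theorem const (g : St → S) : WContinuous mm fun _ : St → S => g :=
  ⟨fun _ _ _ σ => mm.le_refl (g σ), fun _ _ _ _ => wIsSup_iff.2 fun σ => mm.isSup_const (g σ)⟩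

theorem comp {F G : (St → S) → St → S} (hF : WContinuous mm F) (hG : WContinuous mm G) :
    WContinuous mm fun f => F (G f) :=
  ⟨fun _ _ h => hF.1 _ _ (hG.1 _ _ h),
    fun s x hs hx => hF.2 _ _ (hG.chain hs) (hG.2 s x hs hx)⟩

theorem precomp (g : St → St) : WContinuous mm fun (f : St → S) σ => f (g σ) :=
  ⟨fun _ _ h σ => h (g σ), fun _ _ _ hx => wIsSup_iff.2 fun σ => wIsSup_iff.1 hx (g σ)⟩

theorem smul (hcont : OmegaContinuous mm) (u : M) :
    WContinuous mm fun (f : St → S) σ => mm.smul u (f σ) :=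
  ⟨fun _ _ h σ => MonModule.smul_le_smul u (h σ), fun s x hs hx =>
    wIsSup_iff.2 fun σ =>
      hcont.smul_cont u (fun n => s n σ) (x σ) (fun n => hs n σ) (wIsSup_iff.1 hx σ)⟩

theorem iv (φ : Set St) : WContinuous mm (iv mm φ) := by
  refine ⟨fun f g h σ => ?_, fun s x hs hx => wIsSup_iff.2 fun σ => ?_⟩
  · by_cases hσ : σ ∈ φ
    · simpa [_root_.iv, hσ] using h σ
    · simpa [_root_.iv, hσ] using mm.le_refl mm.zero
  · by_cases hσ : σ ∈ φ
    · simpa [_root_.iv, hσ] using wIsSup_iff.1 hx σ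
    · simpa [_root_.iv, hσ] using mm.isSup_const mm.zero

theorem add (hcont : OmegaContinuous mm) {F G : (St → S) → St → S} (hF : WContinuous mm F)
    (hG : WContinuous mm G) : WContinuous mm fun f σ => mm.add (F f σ) (G f σ) :=
  ⟨fun _ _ h σ => MonModule.add_le_add (hF.1 _ _ h σ) (hG.1 _ _ h σ), fun s x hs hx =>
    wIsSup_iff.2 fun σ =>
      MonModule.IsSup.add hcont (fun n => hF.chain hs n σ) (fun n => hG.chain hs n σ)
        (wIsSup_iff.1 (hF.2 s x hs hx) σ) (wIsSup_iff.1 (hG.2 s x hs hx) σ)⟩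

theorem chain_iterate {F : (St → S) → St → S} (hF : WContinuous mm F) :
    WChain mm fun i => F^[i] fun _ => mm.zero := by
  intro n
  induction n with
  | zero => exact fun σ => mm.zero_le _
  | succ n ih =>
    simp only [Function.iterate_succ_apply'] at ih ⊢
    exact hF.1 _ _ ih

/-- Kleene's fixed point theorem: the supremum of the iterates from `𝟘` is a fixed point lying
below every prefixed point. -/
theorem kleene (hord : mm.NaturallyOrdered) {F : (St → S) → St → S}
    (hF : WContinuous mm F) {x : St → S} (hx : WIsSup mm (fun i => F^[i] fun _ => mm.zero) x) :
    F x = x ∧ ∀ y, wle mm (F y) y → wle mm x y := by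
  refine ⟨funext fun σ => ?_, fun y hy => hx.2 y fun n => ?_⟩
  · have hFx := wIsSup_iff.1 (hF.2 _ x hF.chain_iterate hx) σ
    simp only [← Function.iterate_succ_apply' F] at hFx
    exact hFx.unique hord (MonModule.IsSup.succ (fun n => hF.chain_iterate n σ)
      (wIsSup_iff.1 hx σ))
  · induction n with
    | zero => exact fun σ => mm.zero_le _
    | succ n ih =>
      simp only [Function.iterate_succ_apply']
      exact wle_trans (hF.1 _ _ ih) hy

/-- The least fixed point of an ω-continuous function is the supremum of its Kleene iterates. -/
theorem wIsSup_wlfp (hord : mm.NaturallyOrdered) (hcont : OmegaContinuous mm)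
    {F : (St → S) → St → S} (hF : WContinuous mm F) :
    WIsSup mm (fun i => F^[i] fun _ => mm.zero) (wlfp mm F) := by
  obtain ⟨x, hx⟩ := exists_wIsSup hcont hF.chain_iterate
  obtain ⟨hfix, hleast⟩ := hF.kleene hord hx
  have hex : ∃ x : St → S, F x = x ∧ ∀ y : St → S, F y = y → wle mm x y :=
    ⟨x, hfix, fun y hy => hleast y (hy.symm ▸ fun σ => mm.le_refl _)⟩
  have heq : wlfp mm F = x := by
    obtain ⟨hfix', hleast'⟩ := hex.choose_spec
    rw [wlfp, dif_pos hex]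
    exact funext fun σ => hord _ _ (hleast' x hfix σ)
      (hleast _ (by rw [hfix']; exact fun σ => mm.le_refl _) σ)
  rwa [heq]

/-- Least fixed points of `X ↦ G f ⊕ H X` depend ω-continuously on `f`. -/
theorem wlfp_add (hord : mm.NaturallyOrdered) (hcont : OmegaContinuous mm)
    {G H : (St → S) → St → S} (hG : WContinuous mm G) (hH : WContinuous mm H) :
    WContinuous mm fun f => wlfp mm fun X σ => mm.add (G f σ) (H X σ) := by
  have hΦ (f : St → S) : WContinuous mm fun X σ => mm.add (G f σ) (H X σ) :=
    add hcont (const (G f)) hH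
  have hfp (f : St → S) := (hΦ f).kleene hord ((hΦ f).wIsSup_wlfp hord hcont)
  have hmono (f g : St → S) (hfg : wle mm f g) :
      wle mm (wlfp mm fun X σ => mm.add (G f σ) (H X σ))
        (wlfp mm fun X σ => mm.add (G g σ) (H X σ)) := by
    refine (hfp f).2 _ fun σ => ?_
    conv_rhs => rw [← (hfp g).1]
    exact MonModule.add_le_add (hG.1 _ _ hfg σ) (mm.le_refl _)
  refine ⟨hmono, fun s x hs hx => ⟨fun n => hmono _ _ (hx.1 n), fun y hy => ?_⟩⟩
  have hchain : WChain mm fun n => wlfp mm fun X σ => mm.add (G (s n) σ) (H X σ) :=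
    fun n => hmono _ _ (hs n)
  obtain ⟨z, hz⟩ := exists_wIsSup hcont hchain
  refine wle_trans ((hfp x).2 z fun σ => ?_) (hz.2 y hy)
  refine (MonModule.IsSup.add hcont (fun n => hG.chain hs n σ) (fun n => hH.chain hchain n σ)
    (wIsSup_iff.1 (hG.2 s x hs hx) σ) (wIsSup_iff.1 (hH.2 _ z hchain hz) σ)).2 _ fun n => ?_
  simpa only [congrFun (hfp (s n)).1 σ] using hz.1 n σ

end WContinuous

theorem wContinuous_wp (hord : mm.NaturallyOrdered) (hcont : OmegaContinuous mm)
    (C : WGCL M St) : WContinuous mm (wp mm C) := by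
  induction C with
  | assign g => exact .precomp g
  | seq C₁ C₂ ih₁ ih₂ => exact ih₁.comp ih₂
  | ite φ C₁ C₂ ih₁ ih₂ =>
    exact .add hcont ((WContinuous.iv φ).comp ih₁) ((WContinuous.iv φᶜ).comp ih₂)
  | branch C₁ C₂ ih₁ ih₂ => exact .add hcont ih₁ ih₂
  | weight a => exact .smul hcont a
  | wloop φ C ih => exact .wlfp_add hord hcont (.iv φᶜ) ((WContinuous.iv φ).comp ih)

theorem wContinuous_charW (hord : mm.NaturallyOrdered) (hcont : OmegaContinuous mm)
    (φ : Set St) (C : WGCL M St) (f : St → S) : WContinuous mm (charW mm φ C f) :=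
  .add hcont (.const _) ((WContinuous.iv φ).comp (wContinuous_wp hord hcont C))

end Weightings

/-- **Well-definedness of wp** (Theorem: Well-Definedness of `wp`).
For a naturally ordered ω-continuous `M`-module `S`, `wp[C]` is an ω-continuous
endofunction on the module of weightings (monotone and preserving suprema of ω-chains),
and for loops the least fixed point of the characteristic function exists, is attained
by `wp[while(φ){C'}](f)`, and equals the supremum of the Kleene iterates from `𝟘`. -/
theorem wp_well_defined (M S St : Type) [Monoid M] [Countable St] (mm : MonModule M S)
    (hord : mm.NaturallyOrdered) (hcont : OmegaContinuous mm) :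
    (∀ C : WGCL M St,
      (∀ f g : St → S, wle mm f g → wle mm (wp mm C f) (wp mm C g)) ∧
      (∀ (s : ℕ → St → S) (x : St → S), WChain mm s → WIsSup mm s x →
        WIsSup mm (fun n => wp mm C (s n)) (wp mm C x)))
    ∧
    (∀ (φ : Set St) (C' : WGCL M St) (f : St → S),
      (charW mm φ C' f (wp mm (WGCL.wloop φ C') f) = wp mm (WGCL.wloop φ C') f ∧
        ∀ y : St → S, charW mm φ C' f y = y → wle mm (wp mm (WGCL.wloop φ C') f) y)
      ∧
      WIsSup mm (fun i => (charW mm φ C' f)^[i] (fun _ => mm.zero))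
        (wp mm (WGCL.wloop φ C') f)) := by
  refine ⟨wContinuous_wp hord hcont, fun φ C' f => ?_⟩
  have hΦ := wContinuous_charW hord hcont φ C' f
  have hsup := hΦ.wIsSup_wlfp hord hcont
  obtain ⟨hfix, hleast⟩ := hΦ.kleene hord hsup
  exact ⟨⟨hfix, fun y hy => hleast y (by rw [hy]; exact fun σ => mm.le_refl _)⟩, hsup⟩
end

section
/- Decomposition of wlp: let (M,·,1) be a monoid and let S be a naturally ordered ω-bicontinuous M-module. Then for every M-wGCL program C and every weighting f, wlp[C](f) = wp[C](f) ⊕ wlp[C](𝟘), where 𝟘 is the constant-zero weighting. -/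
/-! ## Sequentially Scott-continuous maps and their least fixed points -/

section SeqContinuity

open Set Function

variable {α β γ ι : Type*}

/-- `F` preserves least upper bounds of ascending sequences. -/
def SeqScottContinuous [Preorder α] [Preorder β] (F : α → β) : Prop :=
  ∀ s : ℕ → α, Monotone s → ∀ x : α, IsLUB (range s) x → IsLUB (range (F ∘ s)) (F x)

/-- Every ascending sequence has a least upper bound. -/
def SeqComplete (α : Type*) [Preorder α] : Prop :=
  ∀ s : ℕ → α, Monotone s → ∃ x : α, IsLUB (range s) x

theorem isLUB_range_pi [Preorder β] {s : ℕ → ι → β} {x : ι → β} :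
    IsLUB (range s) x ↔ ∀ i, IsLUB (range fun n => s n i) (x i) := by
  rw [isLUB_pi]
  refine forall_congr' fun i => ?_
  rw [← range_comp]
  rfl

theorem SeqComplete.pi [Preorder β] (h : SeqComplete β) : SeqComplete (ι → β) := by
  intro s hs
  choose x hx using fun i => h (fun n => s n i) fun _ _ hmn => hs hmn i
  exact ⟨x, isLUB_range_pi.2 hx⟩

namespace SeqScottContinuous

theorem monotone [Preorder α] [Preorder β] {F : α → β} (hF : SeqScottContinuous F) :
    Monotone F := by
  intro x y hxy
  have hs : Monotone fun n : ℕ => if n = 0 then x else y := by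
    refine monotone_nat_of_le_succ fun n => ?_
    rcases n with _ | n <;> simp [hxy]
  refine (hF _ hs y ⟨?_, fun z hz => ?_⟩).1 ⟨0, by simp⟩
  · rintro _ ⟨n, rfl⟩
    rcases n with _ | n <;> simp [hxy]
  · exact hz ⟨1, by simp⟩

theorem comp [Preorder α] [Preorder β] [Preorder γ] {G : β → γ} {F : α → β}
    (hG : SeqScottContinuous G) (hF : SeqScottContinuous F) :
    SeqScottContinuous fun a => G (F a) :=
  fun s hs x hx => hG (F ∘ s) (hF.monotone.comp hs) (F x) (hF s hs x hx)

theorem id [Preorder α] : SeqScottContinuous fun a : α => a :=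
  fun _ _ _ hx => hx

theorem const [Preorder α] [Preorder β] (b : β) : SeqScottContinuous fun _ : α => b := by
  intro s _ x _
  have : range ((fun _ : α => b) ∘ s) = {b} := range_const
  rw [this]
  exact isLUB_singleton

theorem apply [Preorder β] (i : ι) : SeqScottContinuous fun f : ι → β => f i :=
  fun _ _ _ hx => isLUB_range_pi.1 hx i

theorem pi [Preorder α] [Preorder β] {F : α → ι → β}
    (h : ∀ i, SeqScottContinuous fun a => F a i) : SeqScottContinuous F :=
  fun s hs x hx => isLUB_range_pi.2 fun i => h i s hs x hx

theorem fst [Preorder α] [Preorder β] : SeqScottContinuous (Prod.fst : α × β → α) := by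
  intro s _ x hx
  rw [range_comp]
  exact (isLUB_prod.1 hx).1

theorem snd [Preorder α] [Preorder β] : SeqScottContinuous (Prod.snd : α × β → β) := by
  intro s _ x hx
  rw [range_comp]
  exact (isLUB_prod.1 hx).2

theorem prodMk [Preorder α] [Preorder β] [Preorder γ] {F : α → β} {G : α → γ}
    (hF : SeqScottContinuous F) (hG : SeqScottContinuous G) :
    SeqScottContinuous fun a => (F a, G a) := by
  intro s hs x hx
  rw [isLUB_prod, ← range_comp, ← range_comp]
  exact ⟨hF s hs x hx, hG s hs x hx⟩

theorem uncurry [Preorder α] [Preorder β] [Preorder γ] {G : α → β → γ}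
    (hl : ∀ b, SeqScottContinuous fun a => G a b) (hr : ∀ a, SeqScottContinuous (G a)) :
    SeqScottContinuous fun p : α × β => G p.1 p.2 := by
  intro s hs x hx
  have h₁ := fst s hs x hx
  have h₂ := snd s hs x hx
  have m₁ : Monotone (Prod.fst ∘ s) := monotone_fst.comp hs
  have m₂ : Monotone (Prod.snd ∘ s) := monotone_snd.comp hs
  refine ⟨?_, fun y hy => ?_⟩
  · rintro _ ⟨n, rfl⟩
    exact ((hl _).monotone (h₁.1 ⟨n, rfl⟩)).trans ((hr _).monotone (h₂.1 ⟨n, rfl⟩))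
  · refine (hl _ _ m₁ _ h₁).2 ?_
    rintro _ ⟨m, rfl⟩
    refine (hr _ _ m₂ _ h₂).2 ?_
    rintro _ ⟨n, rfl⟩
    exact (((hl _).monotone (m₁ (le_max_left m n))).trans
      ((hr _).monotone (m₂ (le_max_right m n)))).trans (hy ⟨max m n, rfl⟩)

theorem comp₂ {δ : Type*} [Preorder α] [Preorder β] [Preorder γ] [Preorder δ]
    {G : α → β → γ} {F₁ : δ → α} {F₂ : δ → β}
    (hl : ∀ b, SeqScottContinuous fun a => G a b) (hr : ∀ a, SeqScottContinuous (G a))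
    (h₁ : SeqScottContinuous F₁) (h₂ : SeqScottContinuous F₂) :
    SeqScottContinuous fun d => G (F₁ d) (F₂ d) :=
  (uncurry hl hr).comp (h₁.prodMk h₂)

theorem monotone_iterate_bot [Preorder α] {F : α → α} (hF : SeqScottContinuous F) {b : α}
    (hb : ∀ a, b ≤ a) : Monotone fun n => F^[n] b :=
  hF.monotone.monotone_iterate_of_le_map (hb _)

/-- Kleene's fixed point theorem. -/
theorem exists_isLeast_fixedPoints [PartialOrder α] {F : α → α} (hF : SeqScottContinuous F)
    (hα : SeqComplete α) {b : α} (hb : ∀ a, b ≤ a) :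
    ∃ x, IsLeast (fixedPoints F) x ∧ IsLUB (range fun n => F^[n] b) x ∧
      ∀ y, F y ≤ y → x ≤ y := by
  have hmono := hF.monotone_iterate_bot hb
  obtain ⟨x, hx⟩ := hα _ hmono
  have hleast : ∀ y, F y ≤ y → x ≤ y := by
    intro y hy
    refine hx.2 ?_
    rintro _ ⟨n, rfl⟩
    induction n with
    | zero => exact hb y
    | succ n ih =>
      simp only [iterate_succ_apply'] at ih ⊢
      exact (hF.monotone ih).trans hy
  have hfix : IsLUB (range fun n => F^[n] b) (F x) := by
    have h := hF _ hmono x hx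
    refine ⟨?_, fun y hy => h.2 ?_⟩
    · rintro _ ⟨n, rfl⟩
      rcases n with _ | n
      · exact hb _
      · exact h.1 ⟨n, (iterate_succ_apply' F n b).symm⟩
    · rintro _ ⟨n, rfl⟩
      exact hy ⟨n + 1, iterate_succ_apply' F n b⟩
  exact ⟨x, ⟨hfix.unique hx, fun y hy => hleast y (le_of_eq hy)⟩, hx, hleast⟩

theorem isLUB_iterate_of_isLeast_fixedPoints [PartialOrder α] {F : α → α}
    (hF : SeqScottContinuous F) (hα : SeqComplete α) {b : α} (hb : ∀ a, b ≤ a) {x : α}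
    (hx : IsLeast (fixedPoints F) x) : IsLUB (range fun n => F^[n] b) x := by
  obtain ⟨y, hy, hlub, -⟩ := hF.exists_isLeast_fixedPoints hα hb
  rwa [hx.unique hy]

/-- The least fixed point of a continuous map depends continuously on a parameter. -/
theorem leastFixedPoint [PartialOrder α] [Preorder β] {F : β → α → α}
    (hF : SeqScottContinuous fun p : β × α => F p.1 p.2) (hα : SeqComplete α) {b : α}
    (hb : ∀ a, b ≤ a) {μ : β → α} (hμ : ∀ f, IsLeast (fixedPoints (F f)) (μ f)) :
    SeqScottContinuous μ := by
  have hpre : ∀ f y, F f y ≤ y → μ f ≤ y := by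
    intro f
    have hc : ∀ f, SeqScottContinuous (F f) := fun f =>
      hF.comp ((const f).prodMk .id)
    obtain ⟨x, hx, -, hle⟩ := (hc f).exists_isLeast_fixedPoints hα hb
    rwa [(hμ f).unique hx]
  have hmono : Monotone μ := by
    intro f g hfg
    refine hpre f _ ?_
    calc F f (μ g) ≤ F g (μ g) := hF.monotone (a := (f, μ g)) (b := (g, μ g)) ⟨hfg, le_rfl⟩
      _ = μ g := (hμ g).1
  intro s hs x hx
  obtain ⟨m, hm⟩ := hα (μ ∘ s) (hmono.comp hs)
  have hpair : IsLUB (range fun n => (s n, μ (s n))) (x, m) := by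
    rw [isLUB_prod, ← range_comp, ← range_comp]
    exact ⟨hx, hm⟩
  have hFm := hF _ (hs.prodMk (hmono.comp hs)) _ hpair
  have heq : (fun p : β × α => F p.1 p.2) ∘ (fun n => (s n, μ (s n))) = μ ∘ s :=
    funext fun n => (hμ (s n)).1
  have heq' : F x m = m := (heq ▸ hFm).unique hm
  have : μ x = m := by
    refine le_antisymm (hpre x m heq'.le) (hm.2 ?_)
    rintro _ ⟨n, rfl⟩
    exact hmono (hx.1 ⟨n, rfl⟩)
  rwa [this]

end SeqScottContinuous

end SeqContinuity

/-! ## Continuity of fixed-point transformers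

The following is stated for an arbitrary partial order on `S`, so that it applies to `wp` with
the natural order and to `wlp` with its reverse. -/

section FixpointSemantics

open Set Function

variable {M S St : Type} [Monoid M]

/-- Pointwise sum of weightings. -/
def wadd (mm : MonModule M S) (f g : St → S) : St → S := fun σ => mm.add (f σ) (g σ)

/-- The characteristic function of a loop with body transformer `B`. -/
noncomputable def loopStep (mm : MonModule M S) (φ : Set St) (B : (St → S) → St → S)
    (f X : St → S) : St → S :=
  wadd mm (iv mm φᶜ f) (iv mm φ (B X))

/-- The clauses of `wp` and `wlp`, where loops denote least fixed points whenever these exist. -/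
structure IsFixpointSemantics [PartialOrder S] (mm : MonModule M S)
    (T : WGCL M St → (St → S) → St → S) : Prop where
  assign : ∀ g f, T (.assign g) f = fun σ => f (g σ)
  seq : ∀ C₁ C₂ f, T (.seq C₁ C₂) f = T C₁ (T C₂ f)
  ite : ∀ φ C₁ C₂ f, T (.ite φ C₁ C₂) f = wadd mm (iv mm φ (T C₁ f)) (iv mm φᶜ (T C₂ f))
  branch : ∀ C₁ C₂ f, T (.branch C₁ C₂) f = wadd mm (T C₁ f) (T C₂ f)
  weight : ∀ a f, T (.weight a) f = fun σ => mm.smul a (f σ)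
  wloop : ∀ φ C f, (∃ x, IsLeast (fixedPoints (loopStep mm φ (T C) f)) x) →
    IsLeast (fixedPoints (loopStep mm φ (T C) f)) (T (.wloop φ C) f)

/-- The order on `S` is pointed and sequentially complete, with continuous operations. -/
structure ContinuousOrder [PartialOrder S] (mm : MonModule M S) (b : S) : Prop where
  bot_le : ∀ a : S, b ≤ a
  complete : SeqComplete S
  add : ∀ a : S, SeqScottContinuous (mm.add a)
  smul : ∀ u : M, SeqScottContinuous (mm.smul u)

namespace ContinuousOrder

variable [PartialOrder S] {mm : MonModule M S} {b : S}

theorem add_left (h : ContinuousOrder mm b) (c : S) :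
    SeqScottContinuous fun a => mm.add a c := by
  simpa only [mm.add_comm _ c] using h.add c

theorem wadd {α : Type*} [Preorder α] (h : ContinuousOrder mm b) {F G : α → St → S}
    (hF : SeqScottContinuous F) (hG : SeqScottContinuous G) :
    SeqScottContinuous fun a => wadd mm (F a) (G a) :=
  .pi fun σ => .comp₂ h.add_left h.add ((SeqScottContinuous.apply σ).comp hF)
    ((SeqScottContinuous.apply σ).comp hG)

theorem _root_.SeqScottContinuous.iv {α : Type*} [Preorder α] {F : α → St → S}
    (hF : SeqScottContinuous F) (φ : Set St) :
    SeqScottContinuous fun a => iv mm φ (F a) := by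
  refine .pi fun σ => ?_
  by_cases hσ : σ ∈ φ
  · simpa only [_root_.iv, if_pos hσ] using (SeqScottContinuous.apply σ).comp hF
  · simpa only [_root_.iv, if_neg hσ] using SeqScottContinuous.const mm.zero

theorem loopStep (h : ContinuousOrder mm b) (φ : Set St) {B : (St → S) → St → S}
    (hB : SeqScottContinuous B) :
    SeqScottContinuous fun p : (St → S) × (St → S) => loopStep mm φ B p.1 p.2 :=
  h.wadd (SeqScottContinuous.fst.iv _) ((hB.comp .snd).iv _)

theorem loopStep_right (h : ContinuousOrder mm b) (φ : Set St) {B : (St → S) → St → S}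
    (hB : SeqScottContinuous B) (f : St → S) : SeqScottContinuous (_root_.loopStep mm φ B f) :=
  (h.loopStep φ hB).comp ((SeqScottContinuous.const f).prodMk .id)

theorem isLeast_wloop (h : ContinuousOrder mm b) {T : WGCL M St → (St → S) → St → S}
    (hT : IsFixpointSemantics mm T) {C : WGCL M St} (hC : SeqScottContinuous (T C))
    (φ : Set St) (f : St → S) :
    IsLeast (fixedPoints (_root_.loopStep mm φ (T C) f)) (T (.wloop φ C) f) := by
  obtain ⟨x, hx, -⟩ := (h.loopStep_right φ hC f).exists_isLeast_fixedPoints h.complete.pi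
    (b := fun _ => b) fun a σ => h.bot_le (a σ)
  exact hT.wloop φ C f ⟨x, hx⟩

theorem isLUB_wloop (h : ContinuousOrder mm b) {T : WGCL M St → (St → S) → St → S}
    (hT : IsFixpointSemantics mm T) {C : WGCL M St} (hC : SeqScottContinuous (T C))
    (φ : Set St) (f : St → S) :
    IsLUB (range fun n => (_root_.loopStep mm φ (T C) f)^[n] fun _ => b) (T (.wloop φ C) f) :=
  (h.loopStep_right φ hC f).isLUB_iterate_of_isLeast_fixedPoints h.complete.pi
    (fun a σ => h.bot_le (a σ)) (h.isLeast_wloop hT hC φ f)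

theorem seqScottContinuous (h : ContinuousOrder mm b) {T : WGCL M St → (St → S) → St → S}
    (hT : IsFixpointSemantics mm T) (C : WGCL M St) : SeqScottContinuous (T C) := by
  induction C with
  | assign g =>
    rw [funext (hT.assign g)]
    exact .pi fun σ => .apply (g σ)
  | seq C₁ C₂ ih₁ ih₂ =>
    rw [funext (hT.seq C₁ C₂)]
    exact ih₁.comp ih₂
  | ite φ C₁ C₂ ih₁ ih₂ =>
    rw [funext (hT.ite φ C₁ C₂)]
    exact h.wadd (ih₁.iv φ) (ih₂.iv φᶜ)
  | branch C₁ C₂ ih₁ ih₂ =>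
    rw [funext (hT.branch C₁ C₂)]
    exact h.wadd ih₁ ih₂
  | weight a =>
    rw [funext (hT.weight a)]
    exact .pi fun σ => (h.smul a).comp (.apply σ)
  | wloop φ C ih =>
    exact (h.loopStep φ ih).leastFixedPoint h.complete.pi (b := fun _ => b)
      (fun a σ => h.bot_le (a σ)) (h.isLeast_wloop hT ih φ)

end ContinuousOrder

end FixpointSemantics

/-! ## Algebra of weightings -/

section WeightingAlgebra

variable {M S St : Type} [Monoid M] (mm : MonModule M S)

theorem MonModule.add_add_add_comm (a b c d : S) :
    mm.add (mm.add a b) (mm.add c d) = mm.add (mm.add a c) (mm.add b d) := by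
  rw [mm.add_assoc, mm.add_assoc, ← mm.add_assoc b, mm.add_comm b c, mm.add_assoc c]

theorem MonModule.zero_add (a : S) : mm.add mm.zero a = a := by
  rw [mm.add_comm, mm.add_zero]

theorem wadd_assoc (f g h : St → S) : wadd mm (wadd mm f g) h = wadd mm f (wadd mm g h) :=
  funext fun _ => mm.add_assoc _ _ _

theorem wadd_wadd_wadd_comm (f g h k : St → S) :
    wadd mm (wadd mm f g) (wadd mm h k) = wadd mm (wadd mm f h) (wadd mm g k) :=
  funext fun _ => mm.add_add_add_comm _ _ _ _

theorem iv_wadd (φ : Set St) (f g : St → S) :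
    iv mm φ (wadd mm f g) = wadd mm (iv mm φ f) (iv mm φ g) := by
  funext σ
  by_cases hσ : σ ∈ φ <;> simp [iv, wadd, hσ, mm.add_zero]

theorem wadd_zero (f : St → S) : wadd mm f (fun _ => mm.zero) = f :=
  funext fun _ => mm.add_zero _

theorem iv_zero (φ : Set St) : iv mm φ (fun _ => mm.zero) = fun _ => mm.zero :=
  funext fun _ => ite_self _

end WeightingAlgebra

/-! ## The natural order and its reverse -/

section NaturalOrder

open Set Function

variable {M S St : Type} [Monoid M] {mm : MonModule M S}

/-- The natural order as a partial order. -/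
@[reducible] def MonModule.naturalOrder (mm : MonModule M S) (hord : mm.NaturallyOrdered) :
    PartialOrder S where
  le := mm.le
  le_refl a := ⟨mm.zero, mm.add_zero a⟩
  le_trans := by
    rintro a _ _ ⟨c, rfl⟩ ⟨d, rfl⟩
    exact ⟨mm.add c d, (mm.add_assoc a c d).symm⟩
  le_antisymm := hord

/-- The reverse of the natural order. -/
@[reducible] def MonModule.reverseOrder (mm : MonModule M S) (hord : mm.NaturallyOrdered) :
    PartialOrder S where
  le a b := mm.le b a
  le_refl a := (mm.naturalOrder hord).le_refl a
  le_trans a b c hab hbc := (mm.naturalOrder hord).le_trans c b a hbc hab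
  le_antisymm a b hab hba := hord a b hba hab

theorem isSup_iff_isLUB (hord : mm.NaturallyOrdered) {s : ℕ → S} {x : S} :
    letI := mm.naturalOrder hord
    mm.IsSup s x ↔ IsLUB (range s) x := by
  simp only [IsLUB, IsLeast, upperBounds, lowerBounds, mem_ofPred_eq, forall_mem_range]
  rfl

theorem isInf_iff_isLUB (hord : mm.NaturallyOrdered) {s : ℕ → S} {x : S} :
    letI := mm.reverseOrder hord
    mm.IsInf s x ↔ IsLUB (range s) x := by
  simp only [IsLUB, IsLeast, upperBounds, lowerBounds, mem_ofPred_eq, forall_mem_range]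
  rfl

theorem OmegaContinuous.continuousOrder (hord : mm.NaturallyOrdered) (h : OmegaContinuous mm) :
    letI := mm.naturalOrder hord
    ContinuousOrder mm mm.zero := by
  let := mm.naturalOrder hord
  have key : ∀ s : ℕ → S, Monotone s → mm.Chain s := fun s hs n => hs n.le_succ
  exact
    { bot_le := fun a => ⟨a, mm.zero_add a⟩
      complete := fun s hs => (h.sup_exists s (key s hs)).imp fun x => (isSup_iff_isLUB hord).1
      add := fun a s hs x hx => (isSup_iff_isLUB hord).1
        (h.add_cont a s x (key s hs) ((isSup_iff_isLUB hord).2 hx))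
      smul := fun u s hs x hx => (isSup_iff_isLUB hord).1
        (h.smul_cont u s x (key s hs) ((isSup_iff_isLUB hord).2 hx)) }

theorem OmegaCocontinuous.continuousOrder (hord : mm.NaturallyOrdered)
    (h : OmegaCocontinuous mm) {t : S} (ht : ∀ a, mm.le a t) :
    letI := mm.reverseOrder hord
    ContinuousOrder mm t := by
  let := mm.reverseOrder hord
  have key : ∀ s : ℕ → S, Monotone s → mm.DChain s := fun s hs n => hs n.le_succ
  exact
    { bot_le := ht
      complete := fun s hs => (h.inf_exists s (key s hs)).imp fun x => (isInf_iff_isLUB hord).1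
      add := fun a s hs x hx => (isInf_iff_isLUB hord).1
        (h.add_cocont a s x (key s hs) ((isInf_iff_isLUB hord).2 hx))
      smul := fun u s hs x hx => (isInf_iff_isLUB hord).1
        (h.smul_cocont u s x (key s hs) ((isInf_iff_isLUB hord).2 hx)) }

theorem isFixpointSemantics_wp (hord : mm.NaturallyOrdered) :
    letI := mm.naturalOrder hord
    IsFixpointSemantics mm (wp mm : WGCL M St → (St → S) → St → S) := by
  let := mm.naturalOrder hord
  refine ⟨fun _ _ => rfl, fun _ _ _ => rfl, fun _ _ _ _ => rfl, fun _ _ _ => rfl,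
    fun _ _ => rfl, fun φ C f hex => ?_⟩
  have hex' : ∃ x : St → S, loopStep mm φ (wp mm C) f x = x ∧
      ∀ y, loopStep mm φ (wp mm C) f y = y → wle mm x y := hex
  have h : wp mm (.wloop φ C) f = hex'.choose := dif_pos hex'
  rw [h]
  exact hex'.choose_spec

theorem isFixpointSemantics_wlp (hord : mm.NaturallyOrdered) :
    letI := mm.reverseOrder hord
    IsFixpointSemantics mm (wlp mm : WGCL M St → (St → S) → St → S) := by
  let := mm.reverseOrder hord
  refine ⟨fun _ _ => rfl, fun _ _ _ => rfl, fun _ _ _ _ => rfl, fun _ _ _ => rfl,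
    fun _ _ => rfl, fun φ C f hex => ?_⟩
  have hex' : ∃ x : St → S, loopStep mm φ (wlp mm C) f x = x ∧
      ∀ y, loopStep mm φ (wlp mm C) f y = y → wle mm y x := hex
  have h : wlp mm (.wloop φ C) f = hex'.choose := dif_pos hex'
  rw [h]
  exact hex'.choose_spec

theorem wp_wadd (hord : mm.NaturallyOrdered) (hc : OmegaContinuous mm) (C : WGCL M St)
    (f g : St → S) : wp mm C (wadd mm f g) = wadd mm (wp mm C f) (wp mm C g) := by
  let := mm.naturalOrder hord
  have ho := hc.continuousOrder hord
  have hT := isFixpointSemantics_wp (St := St) hord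
  induction C generalizing f g with
  | assign h => rfl
  | seq C₁ C₂ ih₁ ih₂ => rw [hT.seq, hT.seq, hT.seq, ih₂, ih₁]
  | ite φ C₁ C₂ ih₁ ih₂ =>
    rw [hT.ite, hT.ite, hT.ite, ih₁, ih₂, iv_wadd, iv_wadd, wadd_wadd_wadd_comm]
  | branch C₁ C₂ ih₁ ih₂ =>
    rw [hT.branch, hT.branch, hT.branch, ih₁, ih₂, wadd_wadd_wadd_comm]
  | weight a => exact funext fun σ => mm.smul_add a (f σ) (g σ)
  | wloop φ C ih =>
    have hC := ho.seqScottContinuous hT C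
    have lub := ho.isLUB_wloop hT hC φ
    have mono : ∀ f, Monotone fun n => (loopStep mm φ (wp mm C) f)^[n] fun _ => mm.zero :=
      fun f => (ho.loopStep_right φ hC f).monotone_iterate_bot fun a σ => ho.bot_le (a σ)
    have iter : ∀ n, (loopStep mm φ (wp mm C) (wadd mm f g))^[n] (fun _ => mm.zero) =
        wadd mm ((loopStep mm φ (wp mm C) f)^[n] fun _ => mm.zero)
          ((loopStep mm φ (wp mm C) g)^[n] fun _ => mm.zero) := by
      intro n
      induction n with
      | zero => exact (wadd_zero mm _).symm
      | succ n hn =>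
        rw [iterate_succ_apply', iterate_succ_apply', iterate_succ_apply', hn]
        simp only [loopStep]
        rw [ih, iv_wadd, iv_wadd, wadd_wadd_wadd_comm]
    have hpair := ho.wadd (St := St) SeqScottContinuous.fst SeqScottContinuous.snd _
      ((mono f).prodMk (mono g)) (wp mm (.wloop φ C) f, wp mm (.wloop φ C) g) (by
        rw [isLUB_prod, ← range_comp, ← range_comp]
        exact ⟨lub f, lub g⟩)
    have hsum := lub (wadd mm f g)
    rw [funext iter] at hsum
    exact hsum.unique hpair

/-- If the loop body decomposes, then so does the characteristic function of the loop. -/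
theorem loopStep_wlp_wadd (hord : mm.NaturallyOrdered) (hc : OmegaContinuous mm) {C : WGCL M St}
    (hC : ∀ f, wlp mm C f = wadd mm (wp mm C f) (wlp mm C fun _ => mm.zero)) (φ : Set St)
    (f a b : St → S) :
    loopStep mm φ (wlp mm C) f (wadd mm a b) =
      wadd mm (loopStep mm φ (wp mm C) f a)
        (loopStep mm φ (wlp mm C) (fun _ => mm.zero) b) := by
  have hab : wlp mm C (wadd mm a b) = wadd mm (wp mm C a) (wlp mm C b) := by
    rw [hC, hC b, wp_wadd hord hc, wadd_assoc]
  simp only [loopStep]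
  rw [hab, iv_wadd, wadd_wadd_wadd_comm, iv_zero, wadd_zero]

theorem wlp_eq_wadd (hord : mm.NaturallyOrdered) (hbi : OmegaBicontinuous mm) (C : WGCL M St)
    (f : St → S) : wlp mm C f = wadd mm (wp mm C f) (wlp mm C fun _ => mm.zero) := by
  obtain ⟨hc, hcc⟩ := hbi
  obtain ⟨t, ht⟩ := hcc.top_exists
  have hw := isFixpointSemantics_wp (St := St) hord
  have hl := isFixpointSemantics_wlp (St := St) hord
  induction C generalizing f with
  | assign h => exact (wadd_zero mm _).symm
  | seq C₁ C₂ ih₁ ih₂ =>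
    change wlp mm C₁ (wlp mm C₂ f) =
      wadd mm (wp mm C₁ (wp mm C₂ f)) (wlp mm C₁ (wlp mm C₂ fun _ => mm.zero))
    rw [ih₁, ih₂, wp_wadd hord hc, wadd_assoc,
      ← ih₁ (wlp mm C₂ fun _ => mm.zero)]
  | ite φ C₁ C₂ ih₁ ih₂ =>
    change wadd mm (iv mm φ (wlp mm C₁ f)) (iv mm φᶜ (wlp mm C₂ f)) =
      wadd mm (wadd mm (iv mm φ (wp mm C₁ f)) (iv mm φᶜ (wp mm C₂ f)))
        (wadd mm (iv mm φ (wlp mm C₁ fun _ => mm.zero)) (iv mm φᶜ (wlp mm C₂ fun _ => mm.zero)))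
    rw [ih₁ f, ih₂ f, iv_wadd, iv_wadd, wadd_wadd_wadd_comm]
  | branch C₁ C₂ ih₁ ih₂ =>
    change wadd mm (wlp mm C₁ f) (wlp mm C₂ f) =
      wadd mm (wadd mm (wp mm C₁ f) (wp mm C₂ f))
        (wadd mm (wlp mm C₁ fun _ => mm.zero) (wlp mm C₂ fun _ => mm.zero))
    rw [ih₁ f, ih₂ f, wadd_wadd_wadd_comm]
  | weight a =>
    have h0 : wlp mm (.weight a) (fun _ : St => mm.zero) = fun _ => mm.zero :=
      funext fun _ => mm.smul_zero a
    rw [h0, wadd_zero]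
    rfl
  | wloop φ C ih =>
    have step := loopStep_wlp_wadd hord hc ih φ f
    have how := hc.continuousOrder hord
    have hCw := @ContinuousOrder.seqScottContinuous M S St _ (mm.naturalOrder hord) _ _ how _ hw C
    have lubw := @ContinuousOrder.isLUB_wloop M S St _ (mm.naturalOrder hord) _ _ how _ hw _ hCw φ
    have fixw := (@ContinuousOrder.isLeast_wloop M S St _ (mm.naturalOrder hord) _ _ how _ hw _
      hCw φ f).1
    let := mm.reverseOrder hord
    have hol := hcc.continuousOrder hord ht
    have hCl := hol.seqScottContinuous hl C
    have iter : ∀ n, (loopStep mm φ (wlp mm C) f)^[n] (fun _ => t) =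
        wadd mm ((loopStep mm φ (wp mm C) f)^[n] fun _ => mm.zero)
          ((loopStep mm φ (wlp mm C) fun _ => mm.zero)^[n] fun _ => t) := by
      intro n
      induction n with
      | zero => exact funext fun _ => (mm.zero_add t).symm
      | succ n hn =>
        rw [iterate_succ_apply', iterate_succ_apply', iterate_succ_apply', hn, step]
    have lubl := hol.isLUB_wloop hl hCl φ
    have least := hol.isLeast_wloop hl hCl φ
    have mono := (hol.loopStep_right φ hCl fun _ => mm.zero).monotone_iterate_bot
      (b := fun _ => t) fun a σ => hol.bot_le (a σ)
    refine le_antisymm ((least f).2 ?_) ?_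
    · change loopStep mm φ (wlp mm C) f _ = _
      rw [step, (least fun _ => mm.zero).1.eq, fixw.eq]
    · refine (hol.wadd (SeqScottContinuous.const _) .id _ mono _
        (lubl fun _ => mm.zero)).2 ?_
      rintro _ ⟨n, rfl⟩
      refine le_trans ?_ ((lubl f).1 ⟨n, rfl⟩)
      intro σ
      have hn := iter n
      simp only [hn]
      exact (hol.add_left _).monotone ((lubw f).1 ⟨n, rfl⟩ σ)

end NaturalOrder

/-- **Decomposition of wlp**: for a naturally ordered ω-bicontinuous `M`-module `S`,
every program `C` and weighting `f`, `wlp[C](f) = wp[C](f) ⊕ wlp[C](𝟘)`. -/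
theorem wlp_decomposition (M S St : Type) [Monoid M] [Countable St] (mm : MonModule M S)
    (hord : mm.NaturallyOrdered) (hbi : OmegaBicontinuous mm) :
    ∀ (C : WGCL M St) (f : St → S),
      wlp mm C f = fun σ => mm.add (wp mm C f σ) (wlp mm C (fun _ => mm.zero) σ) := by
  exact wlp_eq_wadd hord hbi
end
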